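/- Let G be a finite simple bipartite graph on n vertices that is 4k-intercyclic (contains no two vertex-disjoint cycles each of length divisible by 4). Define f(G,x) = π(G,x) − φ_p(G,x), where π(G,x) = per(xI − A(G)) is the permanental polynomial and φ_p(G,x) = Σ_{i even} (−1)^{i/2} a_i x^{n−i} is the modified characteristic polynomial. Then f(G,x) = 4 Σ_{R ∈ C_{4k}(G)} π(G∖R, x), where C_{4k}(G) denotes the set of all cycles of G whose length is divisible by 4 and G∖R is the induced subgraph obtained by deleting the vertices of R. -/

import Mathlib

open Polynomial SimpleGraph
open scoped Classical

noncomputable section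

/-- The adjacency matrix of a simple graph `G`, with entries in `R`. -/
def adjMat (R : Type*) [Zero R] [One R] {V : Type*} [Fintype V] (G : SimpleGraph V) :
    Matrix V V R := fun u v => if G.Adj u v then 1 else 0

/-- The characteristic polynomial `det (xI - A(G))` of a simple graph `G`. -/
def charPolyG (R : Type*) [CommRing R] {V : Type*} [Fintype V] (G : SimpleGraph V) : R[X] :=
  (adjMat R G).charpoly

/-- The permanental polynomial `per (xI - A(G))` of a simple graph `G`. -/
def permPolyG (R : Type*) [CommRing R] {V : Type*} [Fintype V] (G : SimpleGraph V) : R[X] :=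
  (Matrix.charmatrix (adjMat R G)).permanent

/-- The modified characteristic polynomial `φ_p(G,x) = ∑_{i even} (-1)^{i/2} a_i x^{n-i}`
of a (bipartite) graph `G` on `n` vertices, where `a_i` is the coefficient of `x^{n-i}`
in the characteristic polynomial. -/
def phiP {V : Type*} [Fintype V] (G : SimpleGraph V) : ℝ[X] :=
  ∑ i ∈ Finset.range (Fintype.card V + 1),
    if Even i then
      C ((-1 : ℝ) ^ (i / 2) * (charPolyG ℝ G).coeff (Fintype.card V - i)) *
        X ^ (Fintype.card V - i)
    else 0

/-- `G` contains no cycle whose length is divisible by 4. -/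
def C4kFree {V : Type*} (G : SimpleGraph V) : Prop :=
  ¬ ∃ (v : V) (c : G.Walk v v), c.IsCycle ∧ 4 ∣ c.length

/-- `G` is `4k`-intercyclic: it contains no two vertex-disjoint cycles,
each of length divisible by 4. -/
def Intercyclic4k {V : Type*} (G : SimpleGraph V) : Prop :=
  ¬ ∃ (u v : V) (c : G.Walk u u) (d : G.Walk v v),
      c.IsCycle ∧ d.IsCycle ∧ 4 ∣ c.length ∧ 4 ∣ d.length ∧
      ∀ x, x ∈ c.support → x ∉ d.support

/-- A subgraph `R` of `G` is a cycle of `G` if it is the subgraph traced by some cycle walk. -/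
def IsCycleSubgraph {V : Type*} (G : SimpleGraph V) (R : G.Subgraph) : Prop :=
  ∃ (v : V) (c : G.Walk v v), c.IsCycle ∧ R = c.toSubgraph

/-- The set of all `4k`-cycles (cycles of length divisible by 4) of `G`,
viewed as subgraphs. -/
def cycles4k {V : Type*} (G : SimpleGraph V) : Set G.Subgraph :=
  {R | ∃ (v : V) (c : G.Walk v v), c.IsCycle ∧ 4 ∣ c.length ∧ R = c.toSubgraph}

/-- The connected component `c` of the subgraph `H` is a single edge (a `K₂`). -/
def IsEdgeComp {V : Type*} {G : SimpleGraph V} (H : G.Subgraph)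
    (c : H.coe.ConnectedComponent) : Prop :=
  ∃ x y : H.verts, H.coe.Adj x y ∧ c.supp = {x, y}

/-- The connected component `c` of the subgraph `H` is a cycle: there is a cycle walk whose
support is exactly `c` and which uses every edge of `H` inside `c`. -/
def IsCycleComp {V : Type*} {G : SimpleGraph V} (H : G.Subgraph)
    (c : H.coe.ConnectedComponent) : Prop :=
  ∃ (v : H.verts) (w : H.coe.Walk v v), w.IsCycle ∧
    {x | x ∈ w.support} = c.supp ∧
    ∀ x y : H.verts, H.coe.Adj x y → x ∈ c.supp → w.toSubgraph.Adj x y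

/-- A Sachs subgraph of `G`: a subgraph each of whose connected components is either
a single edge or a cycle. -/
def IsSachs {V : Type*} {G : SimpleGraph V} (H : G.Subgraph) : Prop :=
  ∀ c : H.coe.ConnectedComponent, IsEdgeComp H c ∨ IsCycleComp H c

/-- The number of connected components of the subgraph `H`. -/
def pCount {V : Type*} {G : SimpleGraph V} (H : G.Subgraph) : ℕ :=
  Nat.card H.coe.ConnectedComponent

/-- The number of components of `H` that are cycles of length divisible by 4. -/
def sCount {V : Type*} {G : SimpleGraph V} (H : G.Subgraph) : ℕ :=
  Set.ncard {c : H.coe.ConnectedComponent | IsCycleComp H c ∧ c.supp.ncard % 4 = 0}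

/-- The number of components of `H` that are cycles of length congruent to 2 mod 4. -/
def tCount {V : Type*} {G : SimpleGraph V} (H : G.Subgraph) : ℕ :=
  Set.ncard {c : H.coe.ConnectedComponent | IsCycleComp H c ∧ c.supp.ncard % 4 = 2}

/-- The number of components of `H` that are cycles. -/
def cycCount {V : Type*} {G : SimpleGraph V} (H : G.Subgraph) : ℕ :=
  Set.ncard {c : H.coe.ConnectedComponent | IsCycleComp H c}

/-- `R` is a union of connected components of `H`. -/
def IsComponentUnion {V : Type*} {G : SimpleGraph V} (R H : G.Subgraph) : Prop :=
  R ≤ H ∧ ∀ x y, H.Adj x y → x ∈ R.verts → R.Adj x y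


open Equiv Equiv.Perm

/-- `σ` moves vertices only along edges of `G`. -/
def MovesAlong {V : Type*} (G : SimpleGraph V) (σ : Perm V) : Prop :=
  ∀ v, σ v ≠ v → G.Adj v (σ v)

section

variable {V : Type*} {G : SimpleGraph V} {σ τ : Perm V}

lemma MovesAlong.inv (h : MovesAlong G σ) : MovesAlong G σ⁻¹ := by
  intro v hv
  have h1 := h (σ⁻¹ v)
  rw [show σ (σ⁻¹ v) = v from σ.apply_symm_apply v] at h1
  exact (h1 hv.symm).symm

lemma MovesAlong.exists_walk (h : MovesAlong G σ) {x : V} (hx : σ x ≠ x) (n : ℕ) :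
    ∃ w : G.Walk x ((σ ^ n) x), w.length = n ∧ ∀ i ≤ n, w.getVert i = (σ ^ i) x := by
  induction n with
  | zero => exact ⟨Walk.nil, rfl, fun i hi => by obtain rfl := Nat.le_zero.mp hi; rfl⟩
  | succ n ih =>
    obtain ⟨w, hw, hv⟩ := ih
    have hmove : σ ((σ ^ n) x) ≠ (σ ^ n) x := by
      rw [Ne, apply_pow_apply_eq_iff]
      exact hx
    have hadj : G.Adj ((σ ^ n) x) ((σ ^ (n + 1)) x) := by
      rw [pow_succ', Perm.mul_apply]
      exact h _ hmove
    refine ⟨w.concat hadj, by simp [hw], fun i hi => ?_⟩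
    rw [Walk.concat_eq_append, Walk.getVert_append, hw]
    split_ifs with hin
    · exact hv i hin.le
    · obtain rfl | rfl : i = n ∨ i = n + 1 := by omega
      · simp
      · simp

/-- The subgraph of `G` traced by the nontrivial orbits of a permutation moving along edges. -/
def permSubgraph (G : SimpleGraph V) (σ : Perm V) : G.Subgraph where
  verts := {v | σ v ≠ v}
  Adj u v := G.Adj u v ∧ (σ u = v ∨ σ v = u)
  adj_sub h := h.1
  edge_vert := by
    rintro u v ⟨h, rfl | rfl⟩
    · exact h.ne'
    · exact fun e => h.ne (σ.injective e)
  symm := ⟨fun u v h => ⟨h.1.symm, h.2.symm⟩⟩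

lemma permSubgraph_inv : permSubgraph G σ⁻¹ = permSubgraph G σ := by
  ext u v
  · simp only [permSubgraph, Set.mem_ofPred_eq, Ne, Perm.inv_eq_iff_eq]
    rw [eq_comm]
  · simp only [permSubgraph, Perm.inv_eq_iff_eq]
    grind

variable [Fintype V]

lemma Equiv.Perm.IsCycle.injOn_pow_apply (hσ : σ.IsCycle) {x : V} (hx : σ x ≠ x) {i j : ℕ}
    (hi : i < σ.support.card) (hj : j < σ.support.card) (hij : (σ ^ i) x = (σ ^ j) x) :
    i = j := by
  wlog hle : i ≤ j generalizing i j
  · exact (this hj hi hij.symm (by omega)).symm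
  have h1 : (σ ^ (j - i)) x = x := by
    have h2 : (σ ^ i) ((σ ^ (j - i)) x) = (σ ^ i) x := by
      rw [← Perm.mul_apply, ← pow_add, Nat.add_sub_cancel' hle, hij]
    exact (σ ^ i).injective h2
  have h3 : σ ^ (j - i) = 1 := (hσ.pow_eq_one_iff' hx).mpr h1
  have h4 := orderOf_dvd_of_pow_eq_one h3
  rw [hσ.orderOf] at h4
  have := Nat.eq_zero_of_dvd_of_lt h4 (by omega)
  omega

lemma Equiv.Perm.IsCycle.exists_pow_apply_eq (hσ : σ.IsCycle) {x y : V} (hx : σ x ≠ x)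
    (hy : σ y ≠ y) : ∃ i < σ.support.card, (σ ^ i) x = y := by
  have := (hσ.sameCycle hx hy).exists_pow_eq'
  rwa [hσ.orderOf] at this

lemma MovesAlong.exists_isCycle (h : MovesAlong G σ) (hσ : σ.IsCycle) (h3 : 3 ≤ σ.support.card) :
    ∃ (x : V) (w : G.Walk x x), w.IsCycle ∧ w.length = σ.support.card ∧
      w.toSubgraph = permSubgraph G σ := by
  obtain ⟨x, hx, -⟩ := id hσ
  have hpow : (σ ^ σ.support.card) x = x := by rw [← hσ.orderOf, pow_orderOf_eq_one]; rfl
  obtain ⟨w, hlen, hget⟩ := h.exists_walk hx σ.support.card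
  generalize hn : σ.support.card = n at *
  obtain ⟨w, hlen, hget⟩ : ∃ w : G.Walk x x, w.length = n ∧ ∀ i ≤ n, w.getVert i = (σ ^ i) x :=
    ⟨w.copy rfl hpow, by simpa using hlen, by simpa using hget⟩
  have hmoved (i : ℕ) : σ ((σ ^ i) x) ≠ (σ ^ i) x := by
    rw [Ne, apply_pow_apply_eq_iff]
    exact hx
  refine ⟨x, w, ?_, hlen, ?_⟩
  · rw [Walk.isCycle_iff_isPath_tail_and_le_length, Walk.isPath_iff_injective_get_support]
    refine ⟨?_, by omega⟩
    rintro ⟨i, hi⟩ ⟨j, hj⟩ hij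
    have hl := w.length_tail_add_one (Walk.not_nil_iff_lt_length.mpr (by omega))
    rw [Walk.length_support] at hi hj
    simp only [List.get_eq_getElem, Walk.support_getElem_eq_getVert, Walk.getVert_tail] at hij
    rw [hget _ (by omega), hget _ (by omega), pow_succ', pow_succ', Perm.mul_apply,
      Perm.mul_apply] at hij
    have := hσ.injOn_pow_apply hx (by omega) (by omega) (σ.injective hij)
    simpa using this
  · ext u v
    · rw [Walk.mem_verts_toSubgraph, Walk.mem_support_iff_exists_getVert, hlen]
      constructor
      · rintro ⟨i, rfl, hi⟩
        rw [hget i hi]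
        exact hmoved i
      · intro hu
        obtain ⟨i, hi, rfl⟩ := hσ.exists_pow_apply_eq hx hu
        exact ⟨i, hget i (by omega), by omega⟩
    · have key (i : ℕ) (hi : i < n) : w.getVert (i + 1) = σ (w.getVert i) := by
        rw [hget _ hi.le, hget _ hi, pow_succ', Perm.mul_apply]
      have hv (u v : V) (hadj : G.Adj u v) (hu : σ u = v) :
          ∃ i, w.getVert i = u ∧ w.getVert (i + 1) = v ∧ i < n := by
        obtain ⟨i, hi, rfl⟩ := hσ.exists_pow_apply_eq hx (hu ▸ hadj.ne')
        refine ⟨i, hget i (by omega), ?_, by omega⟩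
        rw [key i (by omega), hget i (by omega), hu]
      rw [Walk.toSubgraph_adj_iff, hlen]
      constructor
      · rintro ⟨i, he, hi⟩
        have hadj := w.adj_getVert_succ (hlen.symm ▸ hi)
        rw [Sym2.eq_iff] at he
        rw [key i hi] at he hadj
        obtain ⟨rfl, rfl⟩ | ⟨rfl, rfl⟩ := he
        · exact ⟨hadj, Or.inl rfl⟩
        · exact ⟨hadj.symm, Or.inr rfl⟩
      · rintro ⟨hadj, hu | hu⟩
        · obtain ⟨i, rfl, rfl, hi⟩ := hv u v hadj hu
          exact ⟨i, rfl, hi⟩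
        · obtain ⟨i, rfl, rfl, hi⟩ := hv v u hadj.symm hu
          exact ⟨i, Sym2.eq_swap, hi⟩

lemma SimpleGraph.Walk.IsCycle.exists_perm {x : V} {w : G.Walk x x} (hw : w.IsCycle) :
    ∃ σ : Perm V, σ.IsCycle ∧ MovesAlong G σ ∧ σ.support.card = w.length ∧
      w.toSubgraph = permSubgraph G σ := by
  have h3 := hw.three_le_length
  set l := w.support.tail with hl
  have hnd : l.Nodup := hw.support_nodup
  have hlen : l.length = w.length := by simp [hl]
  have hget (i : ℕ) (hi : i < l.length) : l[i] = w.getVert (i + 1) := by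
    simp [hl, Walk.support_getElem_eq_getVert]
  have hmem (v : V) : v ∈ l ↔ v ∈ w.support := by
    rw [Walk.mem_support_iff]
    refine ⟨Or.inr, ?_⟩
    rintro (rfl | h)
    · exact Walk.end_mem_tail_support hw.not_nil
    · exact h
  have hsupp : (l.formPerm).support = l.toFinset :=
    List.support_formPerm_of_nodup l hnd (fun y hy => by rw [hy] at hlen; simp at hlen; omega)
  have hmove (v : V) : l.formPerm v ≠ v ↔ v ∈ w.support := by
    rw [← hmem, ← Perm.mem_support, hsupp, List.mem_toFinset]
  have key (i : ℕ) (hi : i < w.length) : l.formPerm (w.getVert i) = w.getVert (i + 1) := by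
    rcases i with _ | i
    · have h1 := List.formPerm_apply_getElem l hnd (w.length - 1) (by omega)
      simp only [hget, hlen, Nat.sub_add_cancel (show 1 ≤ w.length by omega), Nat.mod_self,
        Walk.getVert_length] at h1
      simpa using h1
    · have h1 := List.formPerm_apply_getElem l hnd i (by omega)
      simp only [hget, hlen, Nat.mod_eq_of_lt hi] at h1
      exact h1
  have hex (v : V) (hv : v ∈ w.support) : ∃ i < w.length, w.getVert i = v := by
    obtain ⟨i, rfl, hi⟩ := Walk.mem_support_iff_exists_getVert.mp hv
    obtain hi | rfl := hi.lt_or_eq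
    · exact ⟨i, hi, rfl⟩
    · exact ⟨0, by omega, by simp⟩
  refine ⟨l.formPerm, List.isCycle_formPerm hnd (by omega), ?_, ?_, ?_⟩
  · intro v hv
    obtain ⟨i, hi, rfl⟩ := hex v ((hmove v).mp hv)
    rw [key i hi]
    exact w.adj_getVert_succ hi
  · rw [hsupp, List.toFinset_card_of_nodup hnd, hlen]
  · ext u v
    · rw [Walk.mem_verts_toSubgraph, ← hmove]
      rfl
    · rw [Walk.toSubgraph_adj_iff]
      have hv (u v : V) (hadj : G.Adj u v) (hu : l.formPerm u = v) :
          ∃ i, w.getVert i = u ∧ w.getVert (i + 1) = v ∧ i < w.length := by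
        obtain ⟨i, hi, rfl⟩ := hex u ((hmove u).mp (hu ▸ hadj.ne'))
        exact ⟨i, rfl, by rw [← key i hi, hu], hi⟩
      constructor
      · rintro ⟨i, he, hi⟩
        have hadj := w.adj_getVert_succ hi
        rw [Sym2.eq_iff] at he
        rw [← key i hi] at he hadj
        obtain ⟨rfl, rfl⟩ | ⟨rfl, rfl⟩ := he
        · exact ⟨hadj, Or.inl rfl⟩
        · exact ⟨hadj.symm, Or.inr rfl⟩
      · rintro ⟨hadj, hu | hu⟩
        · obtain ⟨i, rfl, rfl, hi⟩ := hv u v hadj hu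
          exact ⟨i, rfl, hi⟩
        · obtain ⟨i, rfl, rfl, hi⟩ := hv v u hadj.symm hu
          exact ⟨i, Sym2.eq_swap, hi⟩

lemma Equiv.Perm.IsCycle.sq_apply_ne (hσ : σ.IsCycle) (h3 : 3 ≤ σ.support.card) {x : V}
    (hx : σ x ≠ x) : σ (σ x) ≠ x := by
  intro h
  have := hσ.injOn_pow_apply hx (i := 2) (j := 0) (by omega) (by omega)
    (by rw [pow_two]; simpa using h)
  omega

lemma eq_of_permSubgraph_eq (hσ : σ.IsCycle) (h3 : 3 ≤ σ.support.card)
    (hG : MovesAlong G σ)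
    (h : permSubgraph G σ = permSubgraph G τ) {x : V} (hx : σ x ≠ x)
    (hxe : τ x = σ x) : τ = σ := by
  have hverts (v : V) : σ v ≠ v ↔ τ v ≠ v :=
    Set.ext_iff.mp (congrArg Subgraph.verts h) v
  have hadj (v : V) (hv : σ v ≠ v) : τ v = σ v ∨ τ (σ v) = v := by
    have h1 : (permSubgraph G σ).Adj v (σ v) := ⟨hG v hv, Or.inl rfl⟩
    rw [h] at h1
    exact h1.2
  have hpow (i : ℕ) : τ ((σ ^ i) x) = σ ((σ ^ i) x) := by
    induction i with
    | zero => simpa using hxe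
    | succ i ih =>
      rw [pow_succ', Perm.mul_apply]
      generalize hy : (σ ^ i) x = y at ih
      have hym : σ y ≠ y := by rw [← hy, Ne, apply_pow_apply_eq_iff]; exact hx
      have hym' : σ (σ y) ≠ σ y := fun e => hym (σ.injective e)
      refine (hadj _ hym').resolve_right fun h1 => ?_
      exact hσ.sq_apply_ne h3 hym (τ.injective (h1.trans ih.symm))
  ext v
  by_cases hv : σ v = v
  · have := (hverts v).not
    rw [not_not, not_not] at this
    rw [hv, this.mp hv]
  · obtain ⟨i, -, rfl⟩ := hσ.exists_pow_apply_eq hx hv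
    exact hpow i

end

section

variable {V : Type*} [Fintype V] {G : SimpleGraph V} {σ τ : Perm V}

lemma MovesAlong.even_card_support (hcol : G.Colorable 2) (h : MovesAlong G σ) (hσ : σ.IsCycle) :
    Even σ.support.card := by
  obtain ⟨c⟩ : Nonempty (G.Coloring (ZMod 2)) := hcol
  obtain ⟨x, hx, -⟩ := id hσ
  have hne : ∀ a b : ZMod 2, a ≠ b → b = a + 1 := by decide
  have key (i : ℕ) : c ((σ ^ i) x) = c x + (i : ZMod 2) := by
    induction i with
    | zero => simp
    | succ i ih =>
      have hm : σ ((σ ^ i) x) ≠ (σ ^ i) x := by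
        rw [Ne, apply_pow_apply_eq_iff]
        exact hx
      rw [pow_succ', Perm.mul_apply, hne _ _ (c.valid (h _ hm)), ih, Nat.cast_succ, add_assoc]
  have h1 := key (orderOf σ)
  rw [pow_orderOf_eq_one, Perm.one_apply, left_eq_add, ZMod.natCast_eq_zero_iff] at h1
  rw [← hσ.orderOf]
  exact even_iff_two_dvd.mpr h1

lemma MovesAlong.of_mem_cycleFactorsFinset (h : MovesAlong G σ) (hτ : τ ∈ σ.cycleFactorsFinset) :
    MovesAlong G τ := by
  intro v hv
  have := (mem_cycleFactorsFinset_iff.mp hτ).2 v (mem_support.mpr hv)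
  rw [this] at hv ⊢
  exact h v hv

lemma MovesAlong.even_of_mem_cycleType (hcol : G.Colorable 2) (h : MovesAlong G σ) {n : ℕ}
    (hn : n ∈ σ.cycleType) : Even n := by
  rw [cycleType_def, Multiset.mem_map] at hn
  obtain ⟨τ, hτ, rfl⟩ := hn
  exact (h.of_mem_cycleFactorsFinset hτ).even_card_support hcol (mem_cycleFactorsFinset_iff.mp hτ).1

lemma even_sum_of_forall_even {m : Multiset ℕ} (hm : ∀ n ∈ m, Even n) : Even m.sum :=
  even_iff_two_dvd.mpr (Multiset.dvd_sum fun n hn => even_iff_two_dvd.mp (hm n hn))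

lemma neg_one_pow_sum_add_card_mul {m : Multiset ℕ} (hm : ∀ n ∈ m, Even n) :
    (-1 : ℝ) ^ (m.sum + m.card) * (-1) ^ (m.sum / 2) = (-1) ^ (m.countP (4 ∣ ·)) := by
  induction m using Multiset.induction_on with
  | empty => simp
  | cons a m ih =>
    obtain ⟨k, rfl⟩ := hm a (Multiset.mem_cons_self a m)
    have hm' : ∀ n ∈ m, Even n := fun n hn => hm n (Multiset.mem_cons_of_mem hn)
    have h1 : (k + k + m.sum) / 2 = k + m.sum / 2 := by omega
    rw [Multiset.sum_cons, Multiset.card_cons, h1, Multiset.countP_cons,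
      pow_add _ (Multiset.countP _ m),
      ← ih hm']
    have h2 : (-1 : ℝ) ^ (if 4 ∣ k + k then 1 else 0) = - (-1) ^ k := by
      obtain hk | hk := Nat.even_or_odd k
      · rw [if_pos (by obtain ⟨j, rfl⟩ := hk; omega), hk.neg_one_pow, pow_one]
      · rw [if_neg (by obtain ⟨j, rfl⟩ := hk; omega), hk.neg_one_pow, pow_zero, neg_neg]
    have h3 : (-1 : ℝ) ^ (k + k) = 1 := (Even.add_self k).neg_one_pow
    rw [h2, show k + k + m.sum + (m.card + 1) = (k + k) + (m.sum + m.card) + 1 by omega,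
      pow_succ, pow_add _ (k + k), h3, pow_add _ k]
    ring

/-- The cycle factors of `σ` whose length is divisible by 4. -/
def cycleFactors4 (σ : Perm V) : Finset (Perm V) :=
  σ.cycleFactorsFinset.filter (4 ∣ ·.support.card)

lemma MovesAlong.even_card_support_of_colorable (hcol : G.Colorable 2) (h : MovesAlong G σ) :
    Even σ.support.card := by
  rw [← sum_cycleType]
  exact even_sum_of_forall_even fun n hn => h.even_of_mem_cycleType hcol hn

lemma MovesAlong.sign_mul (hcol : G.Colorable 2) (h : MovesAlong G σ) :
    ((sign σ : ℤ) : ℝ) * (-1) ^ (σ.support.card / 2) = (-1) ^ (cycleFactors4 σ).card := by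
  have h1 := neg_one_pow_sum_add_card_mul fun n hn => h.even_of_mem_cycleType hcol hn
  rw [sum_cycleType] at h1
  rw [sign_of_cycleType, sum_cycleType]
  push_cast
  rw [h1, cycleType_def, Multiset.countP_map]
  rfl

lemma MovesAlong.card_cycleFactors4_le (hic : Intercyclic4k G) (h : MovesAlong G σ) :
    (cycleFactors4 σ).card ≤ 1 := by
  rw [Finset.card_le_one]
  intro a ha b hb
  by_contra hab
  simp only [cycleFactors4, Finset.mem_filter] at ha hb
  have key (τ : Perm V) (hτ : τ ∈ σ.cycleFactorsFinset) (h4 : 4 ∣ τ.support.card) :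
      ∃ (x : V) (w : G.Walk x x), w.IsCycle ∧ 4 ∣ w.length ∧ ∀ v, v ∈ w.support → τ v ≠ v := by
    have hc := (mem_cycleFactorsFinset_iff.mp hτ).1
    have h3 : 3 ≤ τ.support.card := by
      have := hc.two_le_card_support
      omega
    obtain ⟨x, w, hw, hl, hs⟩ := (h.of_mem_cycleFactorsFinset hτ).exists_isCycle hc h3
    refine ⟨x, w, hw, hl ▸ h4, fun v hv => ?_⟩
    rw [← Walk.mem_verts_toSubgraph, hs] at hv
    exact hv
  obtain ⟨u, c, hc, hc4, hcs⟩ := key a ha.1 ha.2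
  obtain ⟨v, d, hd, hd4, hds⟩ := key b hb.1 hb.2
  refine hic ⟨u, v, c, d, hc, hd, hc4, hd4, fun x hx hx' => ?_⟩
  exact (cycleFactorsFinset_pairwise_disjoint σ ha.1 hb.1 hab x).elim (hcs x hx) (hds x hx')

/-- The permutations moving vertices only along edges of `G`. -/
def edgePerms (G : SimpleGraph V) : Finset (Perm V) := Finset.univ.filter (MovesAlong G)

lemma mem_edgePerms : σ ∈ edgePerms G ↔ MovesAlong G σ := by simp [edgePerms]

lemma prod_charmatrix_adjMat (σ : Perm V) :
    ∏ i, (adjMat ℝ G).charmatrix (σ i) i =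
      if MovesAlong G σ then (-1) ^ σ.support.card * X ^ (Fintype.card V - σ.support.card)
      else 0 := by
  split_ifs with h
  · rw [← Finset.prod_mul_prod_compl σ.support, ← Finset.card_compl]
    congr 1
    · rw [← Finset.prod_const]
      refine Finset.prod_congr rfl fun i hi => ?_
      rw [Perm.mem_support] at hi
      rw [Matrix.charmatrix_apply_ne _ _ _ hi, adjMat, if_pos (h i hi).symm, C_1]
    · rw [← Finset.prod_const]
      refine Finset.prod_congr rfl fun i hi => ?_
      rw [Finset.mem_compl, notMem_support] at hi
      rw [hi, Matrix.charmatrix_apply_eq, adjMat, if_neg (G.loopless.irrefl i), C_0, sub_zero]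
  · simp only [MovesAlong, not_forall] at h
    obtain ⟨v, hv, hadj⟩ := h
    refine Finset.prod_eq_zero (Finset.mem_univ v) ?_
    rw [Matrix.charmatrix_apply_ne _ _ _ hv, adjMat, if_neg (fun e => hadj e.symm), C_0, neg_zero]

lemma permPolyG_eq_sum (hcol : G.Colorable 2) :
    permPolyG ℝ G = ∑ σ ∈ edgePerms G, X ^ (Fintype.card V - σ.support.card) := by
  rw [permPolyG, Matrix.permanent, edgePerms, Finset.sum_filter]
  refine Finset.sum_congr rfl fun σ _ => ?_
  rw [prod_charmatrix_adjMat]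
  split_ifs with h
  · rw [(h.even_card_support_of_colorable hcol).neg_one_pow, one_mul]
  · rfl

lemma charPolyG_eq_sum (hcol : G.Colorable 2) :
    charPolyG ℝ G =
      ∑ σ ∈ edgePerms G, C ((sign σ : ℤ) : ℝ) * X ^ (Fintype.card V - σ.support.card) := by
  rw [charPolyG, Matrix.charpoly, Matrix.det_apply', edgePerms, Finset.sum_filter]
  refine Finset.sum_congr rfl fun σ _ => ?_
  rw [prod_charmatrix_adjMat]
  split_ifs with h
  · rw [(h.even_card_support_of_colorable hcol).neg_one_pow, one_mul]
    simp
  · rw [mul_zero]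

lemma phiP_eq_sum (hcol : G.Colorable 2) :
    phiP G = ∑ σ ∈ edgePerms G,
      (-1) ^ (cycleFactors4 σ).card * X ^ (Fintype.card V - σ.support.card) := by
  have hcoeff (k : ℕ) : (charPolyG ℝ G).coeff k = ∑ σ ∈ edgePerms G,
      if k = Fintype.card V - σ.support.card then ((sign σ : ℤ) : ℝ) else 0 := by
    rw [charPolyG_eq_sum hcol, finsetSum_coeff]
    simp only [coeff_C_mul_X_pow]
  rw [phiP]
  have hterm (i : ℕ) : (if Even i then
      C ((-1 : ℝ) ^ (i / 2) * (charPolyG ℝ G).coeff (Fintype.card V - i)) *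
        X ^ (Fintype.card V - i) else 0) = ∑ σ ∈ edgePerms G,
      if Even i ∧ Fintype.card V - i = Fintype.card V - σ.support.card then
        C (((sign σ : ℤ) : ℝ) * (-1) ^ (i / 2)) * X ^ (Fintype.card V - i) else 0 := by
    by_cases hi : Even i
    · simp only [hi, true_and, if_true, hcoeff, Finset.mul_sum, map_sum, Finset.sum_mul]
      refine Finset.sum_congr rfl fun σ _ => ?_
      split_ifs
      · rw [mul_comm (_ ^ (i / 2))]
      · simp
    · simp [hi]
  simp only [hterm]
  rw [Finset.sum_comm]
  refine Finset.sum_congr rfl fun σ hσ => ?_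
  have h := mem_edgePerms.mp hσ
  have hle : σ.support.card ≤ Fintype.card V := Finset.card_le_univ _
  rw [Finset.sum_eq_single σ.support.card]
  · rw [if_pos ⟨h.even_card_support_of_colorable hcol, rfl⟩, h.sign_mul hcol]
    simp
  · intro i hi hne
    rw [Finset.mem_range] at hi
    exact if_neg fun ⟨_, e⟩ => hne (by omega)
  · intro hn
    exact absurd (Finset.mem_range.mpr (by omega)) hn

end

section

variable {V : Type*} [Fintype V] {G : SimpleGraph V} {σ τ : Perm V}

lemma permPolyG_induce_eq_sum (hcol : G.Colorable 2) (hτ : τ.IsCycle) (h : MovesAlong G τ)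
    (S : Set V) [Fintype ↥Sᶜ] (hS : ∀ v, v ∈ S ↔ τ v ≠ v) :
    permPolyG ℝ (G.induce Sᶜ) = ∑ σ ∈ edgePerms G with τ ∈ σ.cycleFactorsFinset,
      X ^ (Fintype.card V - σ.support.card) := by
  have hcompl (v : V) : v ∈ Sᶜ ↔ τ v = v := by rw [Set.mem_compl_iff, hS, not_not]
  have hdisj (ρ : Perm ↥Sᶜ) : Disjoint τ (ofSubtype ρ) := by
    intro v
    by_cases hv : v ∈ Sᶜ
    · exact Or.inl ((hcompl v).mp hv)
    · exact Or.inr (ofSubtype_apply_of_not_mem ρ hv)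
  have hcard : Fintype.card ↥Sᶜ + τ.support.card = Fintype.card V := by
    have h1 : Fintype.card ↥Sᶜ = τ.supportᶜ.card :=
      Fintype.card_of_subtype _ fun v => by
        rw [Finset.mem_compl, notMem_support]
        exact (hcompl v).symm
    rw [h1, Finset.card_compl_add_card]
  have happly (ρ : Perm ↥Sᶜ) (v : V) (hv : v ∈ Sᶜ) :
      (τ * ofSubtype ρ) v = ρ ⟨v, hv⟩ := by
    rw [Perm.mul_apply, ofSubtype_apply_of_mem ρ hv]
    exact (hcompl _).mp (ρ ⟨v, hv⟩).2
  have happly' (ρ : Perm ↥Sᶜ) (v : V) (hv : v ∉ Sᶜ) : (τ * ofSubtype ρ) v = τ v := by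
    rw [Perm.mul_apply, ofSubtype_apply_of_not_mem ρ hv]
  rw [permPolyG_eq_sum (hcol.of_hom (Embedding.induce Sᶜ).toHom)]
  refine Finset.sum_bij (fun ρ _ => τ * ofSubtype ρ) ?_ ?_ ?_ ?_
  · intro ρ hρ
    rw [Finset.mem_filter, mem_edgePerms, mem_cycleFactorsFinset_iff]
    refine ⟨fun v hv => ?_, hτ, fun v hv => ?_⟩
    · by_cases hvS : v ∈ Sᶜ
      · rw [happly ρ v hvS] at hv ⊢
        exact mem_edgePerms.mp hρ ⟨v, hvS⟩ fun e => hv (congrArg Subtype.val e)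
      · rw [happly' ρ v hvS] at hv ⊢
        exact h v hv
    · refine (happly' ρ v fun hvS => ?_).symm
      exact Perm.mem_support.mp hv ((hcompl v).mp hvS)
  · intro ρ _ ρ' _ e
    exact ofSubtype_injective (mul_left_cancel e)
  · intro σ hσ
    rw [Finset.mem_filter, mem_edgePerms, mem_cycleFactorsFinset_iff] at hσ
    obtain ⟨hσ, -, hag⟩ := hσ
    have hfix (v : V) (hv : v ∉ Sᶜ) : (τ⁻¹ * σ) v = v := by
      rw [Perm.mul_apply, ← hag v (Perm.mem_support.mpr fun e => hv ((hcompl v).mpr e))]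
      exact τ.symm_apply_apply v
    have hmem (v : V) : (τ⁻¹ * σ) v ∈ Sᶜ ↔ v ∈ Sᶜ := by
      by_cases hv : v ∈ Sᶜ
      · refine iff_of_true ?_ hv
        by_contra hv'
        rw [(τ⁻¹ * σ).injective (hfix _ hv')] at hv'
        exact hv' hv
      · rw [hfix v hv]
    have heq : ofSubtype ((τ⁻¹ * σ).subtypePerm hmem) = τ⁻¹ * σ :=
      ofSubtype_subtypePerm hmem fun v hv => by
        by_contra hv'
        exact hv (hfix v hv')
    refine ⟨(τ⁻¹ * σ).subtypePerm hmem, mem_edgePerms.mpr fun v hv => ?_, ?_⟩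
    · have h1 := happly ((τ⁻¹ * σ).subtypePerm hmem) v v.2
      rw [heq, mul_inv_cancel_left] at h1
      have h2 : σ v ≠ v := by
        rw [h1]
        exact fun e => hv (Subtype.ext e)
      have h3 := hσ v h2
      rw [h1] at h3
      exact h3
    · rw [heq, mul_inv_cancel_left]
  · intro ρ _
    rw [(hdisj ρ).card_support_mul, support_ofSubtype, Finset.card_map, ← hcard,
      add_comm (Fintype.card _), Nat.add_sub_add_left]
    congr!

/-- The cyclic permutations of length divisible by 4 moving vertices along edges of `G`. -/
def cyclePerms4 (G : SimpleGraph V) : Finset (Perm V) :=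
  Finset.univ.filter fun τ => τ.IsCycle ∧ MovesAlong G τ ∧ 4 ∣ τ.support.card

lemma mem_cyclePerms4 :
    τ ∈ cyclePerms4 G ↔ τ.IsCycle ∧ MovesAlong G τ ∧ 4 ∣ τ.support.card := by
  simp [cyclePerms4]

lemma three_le_of_mem_cyclePerms4 (hτ : τ ∈ cyclePerms4 G) : 3 ≤ τ.support.card := by
  obtain ⟨hc, -, h4⟩ := mem_cyclePerms4.mp hτ
  have := hc.two_le_card_support
  omega

lemma permSubgraph_mem_cycles4k (hτ : τ ∈ cyclePerms4 G) : permSubgraph G τ ∈ cycles4k G := by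
  obtain ⟨hc, h, h4⟩ := mem_cyclePerms4.mp hτ
  obtain ⟨x, w, hw, hl, hs⟩ := h.exists_isCycle hc (three_le_of_mem_cyclePerms4 hτ)
  exact ⟨x, w, hw, hl ▸ h4, hs.symm⟩

lemma card_filter_permSubgraph_eq {R : G.Subgraph} (hR : R ∈ cycles4k G) :
    ((cyclePerms4 G).filter (permSubgraph G · = R)).card = 2 := by
  obtain ⟨x, w, hw, h4, rfl⟩ := hR
  obtain ⟨σ, hσ, h, hl, hs⟩ := hw.exists_perm
  have hmem : σ ∈ cyclePerms4 G := mem_cyclePerms4.mpr ⟨hσ, h, hl ▸ h4⟩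
  have h3 := three_le_of_mem_cyclePerms4 hmem
  have h3' : 3 ≤ σ⁻¹.support.card := by rwa [support_inv]
  rw [hs, Finset.card_eq_two]
  obtain ⟨y, hy, -⟩ := id hσ
  have hy' : σ⁻¹ y ≠ y := fun e => hy (Perm.inv_eq_iff_eq.mp e).symm
  refine ⟨σ, σ⁻¹, fun e => ?_, ?_⟩
  · refine hσ.sq_apply_ne h3 hy ?_
    nth_rewrite 1 [e]
    exact σ.symm_apply_apply y
  · ext τ
    rw [Finset.mem_filter, Finset.mem_insert, Finset.mem_singleton]
    constructor
    · rintro ⟨-, hτs⟩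
      have hadj : (permSubgraph G σ).Adj y (σ y) := ⟨h y hy, Or.inl rfl⟩
      have hadj' : (permSubgraph G σ).Adj y (σ⁻¹ y) :=
        ⟨h.inv y hy', Or.inr (σ.apply_symm_apply y)⟩
      have hτy : τ y ≠ y := by
        have hv : y ∈ (permSubgraph G σ).verts := hy
        rw [← hτs] at hv
        exact hv
      rw [← hτs] at hadj
      obtain h1 | h1 := hadj.2
      · exact Or.inl (eq_of_permSubgraph_eq hσ h3 h hτs.symm hy h1)
      · rw [← hτs] at hadj'
        obtain h2 | h2 := hadj'.2
        · exact Or.inr (eq_of_permSubgraph_eq hσ.inv h3' h.inv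
            (permSubgraph_inv.trans hτs.symm) hy' h2)
        · refine absurd (τ.injective (h1.trans h2.symm)) fun e => hσ.sq_apply_ne h3 hy ?_
          rw [e]
          exact σ.apply_symm_apply y
    · rintro (rfl | rfl)
      · exact ⟨hmem, rfl⟩
      · exact ⟨mem_cyclePerms4.mpr ⟨hσ.inv, h.inv, by rw [support_inv]; exact hl ▸ h4⟩,
          permSubgraph_inv⟩

lemma permPolyG_sub_phiP_eq_sum (hcol : G.Colorable 2) (hic : Intercyclic4k G) :
    permPolyG ℝ G - phiP G = 2 * ∑ τ ∈ cyclePerms4 G,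
      permPolyG ℝ (G.induce ((permSubgraph G τ).vertsᶜ)) := by
  have hinner (τ : Perm V) (hτ : τ ∈ cyclePerms4 G) :
      permPolyG ℝ (G.induce ((permSubgraph G τ).vertsᶜ)) =
        ∑ σ ∈ edgePerms G with τ ∈ σ.cycleFactorsFinset,
          X ^ (Fintype.card V - σ.support.card) := by
    obtain ⟨hc, h, -⟩ := mem_cyclePerms4.mp hτ
    exact permPolyG_induce_eq_sum hcol hc h _ fun v => Iff.rfl
  rw [Finset.sum_congr rfl hinner,
    Finset.sum_comm' (t' := edgePerms G) (s' := fun σ => cycleFactors4 σ), Finset.mul_sum,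
    permPolyG_eq_sum hcol, phiP_eq_sum hcol, ← Finset.sum_sub_distrib]
  · refine Finset.sum_congr rfl fun σ hσ => ?_
    have := (mem_edgePerms.mp hσ).card_cycleFactors4_le hic
    rw [Finset.sum_const]
    interval_cases (cycleFactors4 σ).card
    · simp
    · simp only [pow_one, one_smul]
      ring
  · intro τ σ
    rw [Finset.mem_filter, mem_edgePerms, mem_cyclePerms4, cycleFactors4, Finset.mem_filter]
    constructor
    · rintro ⟨⟨_, _, h4⟩, h, hm⟩
      exact ⟨⟨hm, h4⟩, h⟩
    · rintro ⟨⟨hm, h4⟩, h⟩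
      exact ⟨⟨(mem_cycleFactorsFinset_iff.mp hm).1, h.of_mem_cycleFactorsFinset hm, h4⟩, h, hm⟩

end

/-- For a `4k`-intercyclic bipartite graph `G`,
`f(G,x) = π(G,x) - φ_p(G,x) = 4 ∑_{R ∈ C_{4k}(G)} π(G∖R, x)`, the sum being over all cycles
`R` of `G` of length divisible by 4. -/
theorem stmt_8 {V : Type*} [Fintype V] (G : SimpleGraph V)
    (hbip : G.Colorable 2) (hic : Intercyclic4k G) :
    permPolyG ℝ G - phiP G = 4 * ∑ᶠ R ∈ cycles4k G, permPolyG ℝ (G.induce (R.vertsᶜ)) := by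
  rw [permPolyG_sub_phiP_eq_sum hbip hic,
    finsum_mem_eq_finite_toFinset_sum _ (Set.toFinite (cycles4k G)),
    ← Finset.sum_fiberwise_of_maps_to (g := permSubgraph G) (t := (Set.toFinite _).toFinset)
      fun τ hτ => (Set.Finite.mem_toFinset _).mpr (permSubgraph_mem_cycles4k hτ),
    Finset.mul_sum, Finset.mul_sum]
  refine Finset.sum_congr rfl fun R hR => ?_
  rw [Set.Finite.mem_toFinset] at hR
  rw [Finset.sum_congr rfl (g := fun _ => permPolyG ℝ (G.induce (R.vertsᶜ))), Finset.sum_const,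
    card_filter_permSubgraph_eq hR, two_nsmul]
  · ring
  · intro τ hτ
    rw [← (Finset.mem_filter.mp hτ).2]

end
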